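/- (Vanishing posterior of wider constituents, explicit Hintikka posterior with λ(w) = w and α = 0.) Fix natural numbers c, K with 1 ≤ c ≤ K, and fix i₀ with 1 ≤ i₀ ≤ K−c. For each sample size n define the posterior probability of a single constituent of width c + i₀ as Q(n) = (1/((c+i₀)⁽ⁿ⁾)) / ( Σ_{i=0}^{K−c} C(K−c, i) · (1/((c+i)⁽ⁿ⁾)) ), where m⁽ⁿ⁾ = m(m+1)⋯(m+n−1) is the ascending factorial. Then Q(n) → 0 as n → ∞. -/

import Mathlib

open Filter Finset

/-- The ascending factorial `m⁽ⁿ⁾ = m (m+1) ⋯ (m+n-1)`, as a real number. -/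
noncomputable def ascFac (m n : ℕ) : ℝ :=
  ∏ j ∈ Finset.range n, ((m : ℝ) + j)

theorem ascFac_pos {m : ℕ} (hm : 1 ≤ m) (n : ℕ) : 0 < ascFac m n :=
  Finset.prod_pos fun j _ => by positivity

theorem ascFac_mono {m m' : ℕ} (h : m ≤ m') (n : ℕ) : ascFac m n ≤ ascFac m' n :=
  Finset.prod_le_prod (fun j _ => by positivity) fun j _ => by gcongr

theorem ascFac_mul_add (m n : ℕ) :
    ascFac m n * ((m : ℝ) + n) = m * ascFac (m + 1) n := by
  unfold ascFac
  rw [← Finset.prod_range_succ (fun j : ℕ => (m : ℝ) + j), Finset.prod_range_succ', mul_comm]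
  push_cast
  rw [add_zero]
  congr 1
  exact Finset.prod_congr rfl fun j _ => by ring

theorem ascFac_div_ascFac_add_le {m k : ℕ} (hm : 1 ≤ m) (hk : 1 ≤ k) (n : ℕ) :
    ascFac m n / ascFac (m + k) n ≤ (m : ℝ) / (m + n) := by
  have hpos : (0 : ℝ) < (m : ℝ) + n := by positivity
  rw [div_le_div_iff₀ (ascFac_pos (by omega) n) hpos, ascFac_mul_add]
  exact mul_le_mul_of_nonneg_left (ascFac_mono (by omega) n) (Nat.cast_nonneg m)

/-- The normalizing sum is at least its term of index `0`. -/
theorem one_div_ascFac_le_sum {c : ℕ} (hc : 1 ≤ c) (N n : ℕ) :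
    1 / ascFac c n ≤
      ∑ i ∈ Finset.range (N + 1), (N.choose i : ℝ) * (1 / ascFac (c + i) n) := by
  have h := Finset.single_le_sum
    (f := fun i : ℕ => (N.choose i : ℝ) * (1 / ascFac (c + i) n))
    (fun i _ => mul_nonneg (Nat.cast_nonneg _)
      (one_div_nonneg.2 (ascFac_pos (by omega) n).le))
    (Finset.mem_range.2 N.succ_pos)
  simpa using h

/-- Vanishing posterior of wider constituents, explicit Hintikka posterior
with `λ(w) = w` and `α = 0`: for `1 ≤ c ≤ K` and `1 ≤ i₀ ≤ K - c`, the posterior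
probability of a single constituent of width `c + i₀`,
`Q(n) = (1/(c+i₀)⁽ⁿ⁾) / (∑_{i=0}^{K-c} C(K-c, i) · (1/(c+i)⁽ⁿ⁾))`,
tends to `0` as the sample size `n` tends to infinity. -/
theorem posterior_wider_constituent_tendsto_zero (c K i₀ : ℕ)
    (hc : 1 ≤ c) (hcK : c ≤ K) (hi₀ : 1 ≤ i₀) (hi₀K : i₀ ≤ K - c) :
    Tendsto
      (fun n : ℕ =>
        (1 / ascFac (c + i₀) n) /
          ∑ i ∈ Finset.range (K - c + 1), ((K - c).choose i : ℝ) * (1 / ascFac (c + i) n))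
      atTop (nhds 0) := by
  have hlim : Tendsto (fun n : ℕ => (c : ℝ) / (c + n)) atTop (nhds 0) :=
    (tendsto_atTop_add_const_left _ _ tendsto_natCast_atTop_atTop).const_div_atTop _
  refine squeeze_zero (fun n => ?_) (fun n => ?_) hlim
  · exact div_nonneg (one_div_nonneg.2 (ascFac_pos (by omega) n).le)
      ((one_div_nonneg.2 (ascFac_pos hc n).le).trans (one_div_ascFac_le_sum hc _ n))
  · have hpos := ascFac_pos hc n
    have hpos' : 0 < ascFac (c + i₀) n := ascFac_pos (by omega) n
    calc _ ≤ (1 / ascFac (c + i₀) n) / (1 / ascFac c n) :=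
          div_le_div_of_nonneg_left (one_div_nonneg.2 hpos'.le) (one_div_pos.2 hpos)
            (one_div_ascFac_le_sum hc _ n)
      _ = ascFac c n / ascFac (c + i₀) n := by field_simp
      _ ≤ _ := ascFac_div_ascFac_add_le hc hi₀ n
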